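/- If T : M_n(ℂ) → M_n(ℂ) is a linear map that is positive, trace preserving and unital, then for every 1 ≤ p ≤ ∞ and every A ∈ M_n(ℂ), ‖T(A)‖_p ≤ ‖A‖_p. -/

import Mathlib

open scoped ENNReal ComplexOrder

/-- The singular values of a complex square matrix `A`, i.e. the (square roots of the)
eigenvalues of `Aᴴ * A`. -/
noncomputable def singularValues {n : ℕ} (A : Matrix (Fin n) (Fin n) ℂ) : Fin n → ℝ :=
  fun i => Real.sqrt ((Matrix.posSemidef_conjTranspose_mul_self A).isHermitian.eigenvalues i)

/-- The Schatten `p`-norm `‖A‖_p = (tr |A|^p)^{1/p}`; for `p = ∞` it is the operator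
(largest singular value) norm. -/
noncomputable def schattenNorm {n : ℕ} (p : ℝ≥0∞) (A : Matrix (Fin n) (Fin n) ℂ) : ℝ :=
  if p = ⊤ then ⨆ i, singularValues A i
  else (∑ i, singularValues A i ^ p.toReal) ^ (1 / p.toReal)

/-- A linear map between matrix algebras is positive if it maps positive semi-definite
matrices to positive semi-definite matrices. -/
def IsPositiveMatrixMap {n r : ℕ} (T : Matrix (Fin n) (Fin n) ℂ →ₗ[ℂ] Matrix (Fin r) (Fin r) ℂ) :
    Prop :=
  ∀ A : Matrix (Fin n) (Fin n) ℂ, A.PosSemidef → (T A).PosSemidef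

/-- A linear map between matrix algebras is trace preserving if `tr T(A) = tr A` for all `A`. -/
def IsTracePreservingMap {n r : ℕ}
    (T : Matrix (Fin n) (Fin n) ℂ →ₗ[ℂ] Matrix (Fin r) (Fin r) ℂ) : Prop :=
  ∀ A : Matrix (Fin n) (Fin n) ℂ, (T A).trace = A.trace

open Matrix

lemma aux_phase (z : ℂ) : ∃ c : ℂ, star c * c = 1 ∧ c * z = (‖z‖ : ℂ) := by
  by_cases hz : z = 0
  · exact ⟨1, by simp, by simp [hz]⟩
  · have hn : (‖z‖ : ℂ) ≠ 0 := by simpa using hz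
    have hs : star z * z = (‖z‖ : ℂ) ^ 2 := Complex.conj_mul' _
    refine ⟨star z / ‖z‖, ?_, ?_⟩
    · rw [star_div₀, star_star]
      have : star (‖z‖ : ℂ) = ‖z‖ := Complex.conj_ofReal _
      rw [this, div_mul_div_comm, mul_comm z, hs]
      field_simp
    · rw [div_mul_eq_mul_div, hs]
      field_simp

lemma aux_amgm {n : ℕ} (g : Matrix (Fin n) (Fin n) ℂ →ₗ[ℂ] ℂ)
    (hg : ∀ P : Matrix (Fin n) (Fin n) ℂ, P.PosSemidef → 0 ≤ g P)
    (a b : Matrix (Fin n) (Fin n) ℂ) :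
    2 * ‖g (a * bᴴ)‖ ≤ (g (a * aᴴ)).re + (g (b * bᴴ)).re := by
  have key : ∀ c : ℂ, star c * c = 1 →
      0 ≤ g (a * aᴴ) + g (b * bᴴ) - c * g (a * bᴴ) - star c * g (b * aᴴ) := by
    intro c hc
    have h := hg _ (Matrix.posSemidef_self_mul_conjTranspose (c • a - b))
    have e : (c • a - b) * (c • a - b)ᴴ
        = (star c * c) • (a * aᴴ) + b * bᴴ - c • (a * bᴴ) - star c • (b * aᴴ) := by
      simp only [conjTranspose_sub, conjTranspose_smul, sub_mul, mul_sub, smul_mul_assoc,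
        mul_smul_comm, smul_sub, mul_smul]
      abel
    rw [e, hc] at h
    simpa using h
  have ha := hg _ (Matrix.posSemidef_self_mul_conjTranspose a)
  have hb := hg _ (Matrix.posSemidef_self_mul_conjTranspose b)
  have h1 := key 1 (by simp)
  have h2 := key Complex.I (by simp)
  obtain ⟨c, hc, hcz⟩ := aux_phase (g (a * bᴴ))
  have h3 := key c hc
  generalize g (a * aᴴ) = A at *
  generalize g (b * bᴴ) = B at *
  generalize g (a * bᴴ) = z at *
  generalize g (b * aᴴ) = w at *
  rw [Complex.le_def] at *
  simp at ha hb h1 h2 h3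
  have hw : w = star z := by
    apply Complex.ext
    · simp; linarith [h2.2]
    · simp; linarith [h1.2]
  have hcw : star c * w = star (c * z) := by rw [hw]; simp
  have e1 : (c * z).re = ‖z‖ := by rw [hcz]; simp
  have e2 : (star c * w).re = ‖z‖ := by rw [hcw, hcz]; simp
  simp at e1 e2
  linarith [h3.1]

open scoped Matrix.Norms.L2Operator in
lemma aux_spec {n : ℕ} (W : Matrix (Fin n) (Fin n) ℂ) (hW : W ∈ unitary (Matrix (Fin n) (Fin n) ℂ)) :
    ∃ (s : Finset ℂ) (P : ℂ → Matrix (Fin n) (Fin n) ℂ),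
      (∀ l ∈ s, ‖l‖ = 1) ∧ (∀ l, (P l).PosSemidef) ∧ ∑ l ∈ s, P l = 1 ∧
      ∑ l ∈ s, l • P l = W := by
  classical
  have hfin : (spectrum ℂ W).Finite := Matrix.finite_spectrum W
  have hN : IsStarNormal W := ⟨by
    rw [Unitary.mem_iff] at hW
    exact hW.1.trans hW.2.symm⟩
  have hc : ∀ f : ℂ → ℂ, ContinuousOn f (spectrum ℂ W) := fun f => hfin.continuousOn f
  let F : ℂ → ℂ → ℂ := fun l x => if x = l then 1 else 0
  refine ⟨hfin.toFinset, fun l => cfc (F l) W, ?_, ?_, ?_, ?_⟩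
  · intro l hl
    have := spectrum.subset_circle_of_unitary (𝕜 := ℂ) hW (hfin.mem_toFinset.mp hl)
    simpa using this
  · intro l
    have : cfc (F l) W = (cfc (F l) W)ᴴ * cfc (F l) W := by
      rw [← star_eq_conjTranspose, ← cfc_star, ← cfc_mul _ _ _ (hc _) (hc _)]
      congr 1
      ext x
      simp only [F]
      split_ifs <;> simp
    change (cfc (F l) W).PosSemidef
    rw [this]
    exact posSemidef_conjTranspose_mul_self _
  · rw [← cfc_sum _ _ _ (fun i _ => hc _), ← cfc_const_one ℂ W]
    apply cfc_congr
    intro x hx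
    simp only [F, Finset.sum_apply]
    rw [Finset.sum_ite_eq, if_pos (hfin.mem_toFinset.mpr hx)]
  · have : ∀ l, l • cfc (F l) W = cfc (fun x => l * F l x) W := fun l => by
      rw [cfc_const_mul _ _ _ (hc _)]
    simp_rw [this]
    rw [← cfc_sum _ _ _ (fun i _ => hc _)]
    conv_rhs => rw [← cfc_id ℂ W hN]
    apply cfc_congr
    intro x hx
    simp only [F, Finset.sum_apply, mul_ite, mul_one, mul_zero]
    rw [Finset.sum_ite_eq, if_pos (hfin.mem_toFinset.mpr hx)]
    rfl

lemma aux_main {n : ℕ}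
    (f : Matrix (Fin n) (Fin n) ℂ →ₗ[ℂ] Matrix (Fin n) (Fin n) ℂ →ₗ[ℂ] ℂ)
    (hf : ∀ P Q : Matrix (Fin n) (Fin n) ℂ, P.PosSemidef → Q.PosSemidef → 0 ≤ f P Q)
    (h1 : ∀ Q, f 1 Q = Q.trace)
    (W : Matrix (Fin n) (Fin n) ℂ) (hW : W ∈ unitary (Matrix (Fin n) (Fin n) ℂ))
    (a b : Matrix (Fin n) (Fin n) ℂ) (ha : (a * aᴴ).trace = 1) (hb : (b * bᴴ).trace = 1) :
    ‖f W (a * bᴴ)‖ ≤ 1 := by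
  obtain ⟨s, P, hs, hP, hP1, hPW⟩ := aux_spec W hW
  have e : f W (a * bᴴ) = ∑ l ∈ s, l * f (P l) (a * bᴴ) := by
    rw [← hPW]; simp
  have ea : ∑ l ∈ s, (f (P l) (a * aᴴ)).re = 1 := by
    have := h1 (a * aᴴ)
    rw [ha, ← hP1] at this
    have := congrArg Complex.re this
    simpa using this
  have eb : ∑ l ∈ s, (f (P l) (b * bᴴ)).re = 1 := by
    have := h1 (b * bᴴ)
    rw [hb, ← hP1] at this
    have := congrArg Complex.re this
    simpa using this
  have h2 : ∑ l ∈ s, 2 * ‖f (P l) (a * bᴴ)‖ ≤ 1 + 1 := by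
    rw [← ea]
    nth_rw 2 [ea]
    rw [← eb, ← Finset.sum_add_distrib]
    exact Finset.sum_le_sum fun l _ => aux_amgm (f (P l)) (fun Q hQ => hf _ _ (hP l) hQ) a b
  rw [← Finset.mul_sum] at h2
  rw [e]
  refine (norm_sum_le _ _).trans ?_
  have : ∑ l ∈ s, ‖l * f (P l) (a * bᴴ)‖ = ∑ l ∈ s, ‖f (P l) (a * bᴴ)‖ :=
    Finset.sum_congr rfl fun l hl => by rw [norm_mul, hs l hl, one_mul]
  rw [this]
  linarith

lemma aux_rank {n : ℕ} (U : Matrix (Fin n) (Fin n) ℂ) (hU : Uᴴ * U = 1) (j : Fin n) :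
    ((U * single j j 1) * (U * single j j 1)ᴴ).trace = 1 := by
  rw [Matrix.trace_mul_comm, conjTranspose_mul, mul_assoc, ← mul_assoc Uᴴ, hU, one_mul]
  simp

lemma aux_diag {n : ℕ} (c : Fin n → ℂ) : diagonal c = ∑ i, c i • single i i (1:ℂ) := by
  rw [← Matrix.sum_single_eq_diagonal]
  simp

lemma aux_row {n : ℕ}
    (f : Matrix (Fin n) (Fin n) ℂ →ₗ[ℂ] Matrix (Fin n) (Fin n) ℂ →ₗ[ℂ] ℂ)
    (hf : ∀ P Q : Matrix (Fin n) (Fin n) ℂ, P.PosSemidef → Q.PosSemidef → 0 ≤ f P Q)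
    (h1 : ∀ Q, f 1 Q = Q.trace)
    (U V X Y : Matrix (Fin n) (Fin n) ℂ) (hU : Uᴴ * U = 1) (hV : Vᴴ * V = 1)
    (hX : Xᴴ * X = 1) (hY : Yᴴ * Y = 1) (j : Fin n) :
    ∑ i, ‖f (U * single i i 1 * Vᴴ) (X * single j j 1 * Yᴴ)‖ ≤ 1 := by
  choose c hc hcz using fun i => aux_phase (f (U * single i i 1 * Vᴴ) (X * single j j 1 * Yᴴ))
  have hV' : V * Vᴴ = 1 := mul_eq_one_comm.mp hV
  have hU' : U * Uᴴ = 1 := mul_eq_one_comm.mp hU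
  have hD : (diagonal c)ᴴ * diagonal c = 1 := by
    rw [diagonal_conjTranspose, diagonal_mul_diagonal, ← diagonal_one]
    congr 1
    ext i
    exact hc i
  have hD' : diagonal c * (diagonal c)ᴴ = 1 := mul_eq_one_comm.mp hD
  have hW : U * diagonal c * Vᴴ ∈ unitary (Matrix (Fin n) (Fin n) ℂ) := by
    have e : (U * diagonal c * Vᴴ)ᴴ * (U * diagonal c * Vᴴ) = 1 := by
      rw [conjTranspose_mul, conjTranspose_mul, conjTranspose_conjTranspose]
      calc V * ((diagonal c)ᴴ * Uᴴ) * (U * diagonal c * Vᴴ)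
          = V * ((diagonal c)ᴴ * (Uᴴ * U) * diagonal c) * Vᴴ := by simp only [mul_assoc]
        _ = 1 := by rw [hU, mul_one, hD, mul_one, hV']
    exact Unitary.mem_iff.mpr ⟨e, mul_eq_one_comm.mp e⟩
  have hs : X * single j j 1 * Yᴴ = (X * single j j 1) * (Y * single j j 1)ᴴ := by
    rw [conjTranspose_mul, ← mul_assoc, mul_assoc X (single j j 1) (single j j 1)ᴴ]
    simp
  have key := aux_main f hf h1 _ hW _ _ (aux_rank X hX j) (aux_rank Y hY j)
  rw [← hs] at key
  have e : f (U * diagonal c * Vᴴ) (X * single j j 1 * Yᴴ)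
      = ((∑ i, ‖f (U * single i i 1 * Vᴴ) (X * single j j 1 * Yᴴ)‖ : ℝ) : ℂ) := by
    rw [aux_diag, Finset.mul_sum, Finset.sum_mul, map_sum, LinearMap.sum_apply]
    push_cast
    refine Finset.sum_congr rfl fun i _ => ?_
    rw [← hcz i, mul_smul_comm, smul_mul_assoc, map_smul, LinearMap.smul_apply, smul_eq_mul]
  rw [e, Complex.norm_real, Real.norm_eq_abs] at key
  exact (le_abs_self _).trans key

lemma aux_svd {n : ℕ} (A : Matrix (Fin n) (Fin n) ℂ) :
    ∃ U V : Matrix (Fin n) (Fin n) ℂ, Uᴴ * U = 1 ∧ Vᴴ * V = 1 ∧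
      A = U * diagonal (fun i => (singularValues A i : ℂ)) * Vᴴ := by
  classical
  set hA := (Matrix.posSemidef_conjTranspose_mul_self A).isHermitian with hAdef
  set V : Matrix (Fin n) (Fin n) ℂ := hA.eigenvectorUnitary.1 with hVdef
  set s := singularValues A with hs
  have hV : Vᴴ * V = 1 := (Unitary.mem_iff.mp hA.eigenvectorUnitary.2).1
  have hV' : V * Vᴴ = 1 := mul_eq_one_comm.mp hV
  have hs2 : ∀ i, (s i : ℂ) * s i = hA.eigenvalues i := by
    intro i
    rw [← Complex.ofReal_mul]
    congr 1
    exact Real.mul_self_sqrt ((Matrix.posSemidef_conjTranspose_mul_self A).eigenvalues_nonneg i)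
  have hG : (A * V)ᴴ * (A * V) = diagonal (fun i => (s i : ℂ) * s i) := by
    have h := hA.spectral_theorem
    rw [Unitary.conjStarAlgAut_apply] at h
    rw [conjTranspose_mul]
    calc Vᴴ * Aᴴ * (A * V) = Vᴴ * (Aᴴ * A) * V := by simp only [mul_assoc]
      _ = Vᴴ * (V * diagonal (RCLike.ofReal ∘ hA.eigenvalues) * Vᴴ) * V := by
          exact congrArg (fun Z => Vᴴ * Z * V) h
      _ = (Vᴴ * V) * diagonal (RCLike.ofReal ∘ hA.eigenvalues) * (Vᴴ * V) := by
          simp only [mul_assoc]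
      _ = _ := by
          rw [hV, one_mul, mul_one]
          congr 1
          ext i
          rw [hs2]
          rfl
  have hGe : ∀ i j, ∑ k, star ((A * V) k i) * (A * V) k j
      = if i = j then (s i : ℂ) * s i else 0 := by
    intro i j
    have := congrFun (congrFun hG i) j
    rw [diagonal_apply] at this
    rw [← this, Matrix.mul_apply]
    rfl
  let u : Fin n → EuclideanSpace ℂ (Fin n) := fun j =>
    WithLp.toLp 2 (fun k => ((s j : ℂ))⁻¹ * (A * V) k j)
  let S : Set (Fin n) := {j | s j ≠ 0}
  have hu : Orthonormal ℂ (S.domRestrict u) := by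
    rw [orthonormal_iff_ite]
    rintro ⟨i, hi⟩ ⟨j, hj⟩
    have hi' : (s i : ℂ) ≠ 0 := by exact_mod_cast hi
    have e : inner ℂ (u i) (u j) = (s i : ℂ)⁻¹ * (s j : ℂ)⁻¹ *
        ∑ k, star ((A * V) k i) * (A * V) k j := by
      rw [PiLp.inner_apply, Finset.mul_sum]
      refine Finset.sum_congr rfl fun k _ => ?_
      simp [u]
      ring
    simp only [Set.domRestrict_apply, Subtype.mk.injEq]
    rw [e, hGe]
    split_ifs with h
    · subst h
      field_simp
    · simp
  obtain ⟨b, hb⟩ := hu.exists_orthonormalBasis_extension_of_card_eq (by simp)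
  refine ⟨Matrix.of fun i j => b j i, V, ?_, hV, ?_⟩
  · ext i j
    rw [Matrix.mul_apply, Matrix.one_apply]
    have := orthonormal_iff_ite.mp b.orthonormal i j
    rw [← this, PiLp.inner_apply]
    refine Finset.sum_congr rfl fun k _ => ?_
    simp [mul_comm]
  · have : A * V = (Matrix.of fun i j => b j i) * diagonal (fun i => (s i : ℂ)) := by
      ext k j
      rw [mul_diagonal, Matrix.of_apply]
      by_cases hj : s j = 0
      · have h0 := hGe j j
        rw [if_pos rfl, hj] at h0
        have h1 : ∑ k, ‖(A * V) k j‖ ^ 2 = 0 := by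
          have : ((∑ k, ‖(A * V) k j‖ ^ 2 : ℝ) : ℂ) = 0 := by
            push_cast
            simp only [← Complex.conj_mul']
            simpa using h0
          exact_mod_cast this
        have h2 := (Finset.sum_eq_zero_iff_of_nonneg (fun _ _ => by positivity)).mp h1 k
          (Finset.mem_univ _)
        have h3 : (A * V) k j = 0 := by simpa using h2
        rw [h3, hj]; simp
      · rw [hb j hj]
        have hj' : (s j : ℂ) ≠ 0 := by exact_mod_cast hj
        simp only [u]
        field_simp
    rw [← this, mul_assoc, hV', mul_one]

lemma aux_weights {n : ℕ} (T : Matrix (Fin n) (Fin n) ℂ →ₗ[ℂ] Matrix (Fin n) (Fin n) ℂ)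
    (hTpos : IsPositiveMatrixMap T) (hTtr : IsTracePreservingMap T)
    (hTunital : T 1 = 1) (A : Matrix (Fin n) (Fin n) ℂ) :
    ∃ M : Fin n → Fin n → ℝ, (∀ i j, 0 ≤ M i j) ∧ (∀ j, ∑ i, M i j ≤ 1) ∧
      (∀ i, ∑ j, M i j ≤ 1) ∧
      ∀ j, singularValues (T A) j ≤ ∑ i, M i j * singularValues A i := by
  obtain ⟨U, V, hU, hV, hA⟩ := aux_svd A
  obtain ⟨Y, X, hY, hX, hB⟩ := aux_svd (T A)
  let f : Matrix (Fin n) (Fin n) ℂ →ₗ[ℂ] Matrix (Fin n) (Fin n) ℂ →ₗ[ℂ] ℂ :=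
    LinearMap.mk₂ ℂ (fun P Q => (T P * Q).trace)
      (by intros; simp [add_mul]) (by intros; simp) (by intros; simp [mul_add])
      (by intros; simp)
  have hfa : ∀ P Q, f P Q = (T P * Q).trace := fun _ _ => rfl
  have hf : ∀ P Q : Matrix (Fin n) (Fin n) ℂ, P.PosSemidef → Q.PosSemidef → 0 ≤ f P Q := by
    intro P Q hP hQ
    obtain ⟨C, rfl⟩ : ∃ C : Matrix (Fin n) (Fin n) ℂ, Q = Cᴴ * C := by
      open scoped MatrixOrder Matrix.Norms.L2Operator in
      exact CStarAlgebra.nonneg_iff_eq_star_mul_self.mp hQ.nonneg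
    rw [hfa, ← mul_assoc, Matrix.trace_mul_comm, ← mul_assoc]
    exact ((hTpos P hP).mul_mul_conjTranspose_same C).trace_nonneg
  have h1 : ∀ Q, f 1 Q = Q.trace := fun Q => by rw [hfa, hTunital, one_mul]
  have h2 : ∀ P, f.flip 1 P = P.trace := fun P => by
    rw [LinearMap.flip_apply, hfa, mul_one, hTtr]
  refine ⟨fun i j => ‖f (U * single i i 1 * Vᴴ) (X * single j j 1 * Yᴴ)‖,
    fun _ _ => norm_nonneg _, fun j => aux_row f hf h1 U V X Y hU hV hX hY j,
    fun i => aux_row f.flip (fun P Q hP hQ => hf Q P hQ hP) h2 X Y U V hX hY hU hV i, ?_⟩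
  intro j
  have e1 : f A (X * single j j 1 * Yᴴ) = singularValues (T A) j := by
    rw [hfa]
    conv_lhs => rw [hB]
    calc (Y * diagonal (fun i => (singularValues (T A) i : ℂ)) * Xᴴ *
          (X * single j j 1 * Yᴴ)).trace
        = (Y * (diagonal (fun i => (singularValues (T A) i : ℂ)) * (Xᴴ * X) *
          single j j 1 * Yᴴ)).trace := by simp only [mul_assoc]
      _ = _ := by
        rw [Matrix.trace_mul_comm, mul_assoc, mul_assoc, hY, hX, mul_one, mul_one]
        simp [Matrix.trace, diagonal_mul, single_apply]
  have e2 : f A (X * single j j 1 * Yᴴ)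
      = ∑ i, (singularValues A i : ℂ) * f (U * single i i 1 * Vᴴ) (X * single j j 1 * Yᴴ) := by
    conv_lhs => rw [hA]
    rw [aux_diag, Finset.mul_sum, Finset.sum_mul, map_sum, LinearMap.sum_apply]
    refine Finset.sum_congr rfl fun i _ => ?_
    rw [mul_smul_comm, smul_mul_assoc, map_smul, LinearMap.smul_apply, smul_eq_mul]
  have hn : ∀ (B : Matrix (Fin n) (Fin n) ℂ) i, 0 ≤ singularValues B i :=
    fun B i => Real.sqrt_nonneg _
  calc singularValues (T A) j = ‖f A (X * single j j 1 * Yᴴ)‖ := by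
        rw [e1, Complex.norm_real, Real.norm_of_nonneg (hn _ _)]
    _ ≤ _ := by
        rw [e2]
        refine (norm_sum_le _ _).trans (Finset.sum_le_sum fun i _ => ?_)
        rw [norm_mul, Complex.norm_real, Real.norm_of_nonneg (hn _ _), mul_comm]

/-- If `T : M_n(ℂ) → M_n(ℂ)` is positive, trace preserving and unital, then for every
`1 ≤ p ≤ ∞` and every `A`, `‖T(A)‖_p ≤ ‖A‖_p`. -/
theorem schattenNorm_contractive_of_unital
    (n : ℕ) (T : Matrix (Fin n) (Fin n) ℂ →ₗ[ℂ] Matrix (Fin n) (Fin n) ℂ)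
    (hTpos : IsPositiveMatrixMap T) (hTtr : IsTracePreservingMap T)
    (hTunital : T 1 = 1) (p : ℝ≥0∞) (hp : 1 ≤ p) (A : Matrix (Fin n) (Fin n) ℂ) :
    schattenNorm p (T A) ≤ schattenNorm p A := by
  obtain ⟨M, hM, hcol, hrow, hle⟩ := aux_weights T hTpos hTtr hTunital A
  have hn : ∀ (B : Matrix (Fin n) (Fin n) ℂ) i, 0 ≤ singularValues B i :=
    fun B i => Real.sqrt_nonneg _
  unfold schattenNorm
  split_ifs with h
  · have h0 : 0 ≤ ⨆ i, singularValues A i := Real.iSup_nonneg (hn A)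
    refine Real.iSup_le (fun j => (hle j).trans ?_) h0
    calc ∑ i, M i j * singularValues A i ≤ ∑ i, M i j * ⨆ i, singularValues A i :=
          Finset.sum_le_sum fun i _ => mul_le_mul_of_nonneg_left
            (le_ciSup (Set.finite_range _).bddAbove i) (hM i j)
      _ = (∑ i, M i j) * ⨆ i, singularValues A i := by rw [Finset.sum_mul]
      _ ≤ _ := mul_le_of_le_one_left h0 (hcol j)
  · have hq : 1 ≤ p.toReal := by
      have := ENNReal.toReal_mono h hp
      simpa using this
    set q := p.toReal
    have hq0 : 0 < q := by linarith
    refine Real.rpow_le_rpow (Finset.sum_nonneg fun i _ => Real.rpow_nonneg (hn _ _) _) ?_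
      (by positivity)
    have hj : ∀ j, singularValues (T A) j ^ q ≤ ∑ i, M i j * singularValues A i ^ q := by
      intro j
      have hS : 0 ≤ ∑ i, M i j * singularValues A i ^ q :=
        Finset.sum_nonneg fun i _ => mul_nonneg (hM i j) (Real.rpow_nonneg (hn _ _) _)
      have hw := Real.inner_le_weight_mul_Lp_of_nonneg Finset.univ hq (fun i => M i j)
        (fun i => singularValues A i) (fun i => hM i j) (fun i => hn A i)
      have h1 : (∑ i, M i j) ^ (1 - q⁻¹) ≤ 1 :=
        Real.rpow_le_one (Finset.sum_nonneg fun i _ => hM i j) (hcol j)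
          (sub_nonneg.mpr (inv_le_one_of_one_le₀ hq))
      have h2 : singularValues (T A) j ≤ (∑ i, M i j * singularValues A i ^ q) ^ q⁻¹ :=
        (hle j).trans (hw.trans (mul_le_of_le_one_left (Real.rpow_nonneg hS _) h1))
      calc _ ≤ ((∑ i, M i j * singularValues A i ^ q) ^ q⁻¹) ^ q :=
            Real.rpow_le_rpow (hn _ _) h2 hq0.le
        _ = _ := Real.rpow_inv_rpow hS hq0.ne'
    calc ∑ j, singularValues (T A) j ^ q ≤ ∑ j, ∑ i, M i j * singularValues A i ^ q :=
          Finset.sum_le_sum fun j _ => hj j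
      _ = ∑ i, (∑ j, M i j) * singularValues A i ^ q := by
          rw [Finset.sum_comm]
          simp only [Finset.sum_mul]
      _ ≤ _ := Finset.sum_le_sum fun i _ =>
          mul_le_of_le_one_left (Real.rpow_nonneg (hn _ _) _) (hrow i)
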